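/- Strong duality for the inner problem: for every attack vector z : J → ℝ (values in {0,1}) such that S(z) is nonempty, the minimum of f over S(z) equals the supremum of D_z over all dual-feasible tuples, and this supremum is attained by some dual-feasible tuple. -/

import Mathlib

open Finset

variable {m n : ℕ}

/-- The defender's feasible set `S(z)` given the attack vector `z`. -/
def Feas (lam : Fin m → ℝ) (C : Fin n → ℝ) (a : Fin m → Fin n → ℝ)
    (θ β : ℝ) (z : Fin n → ℝ) : Set ((Fin m → Fin n → ℝ) × (Fin m → ℝ)) :=
  {p | (∀ i j, 0 ≤ p.1 i j) ∧ (∀ i, 0 ≤ p.2 i) ∧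
       (∀ j, ∑ i, p.1 i j ≤ C j * (1 - z j)) ∧
       (∀ i, (∑ j, p.1 i j) + p.2 i = lam i) ∧
       (∀ i j, p.1 i j ≤ C j * a i j) ∧
       (∀ i, p.2 i / lam i ≤ θ) ∧
       (∀ i i', |p.2 i / lam i - p.2 i' / lam i'| ≤ β)}

/-- The defender's cost `f(x, q)`. -/
def cost (d : Fin m → Fin n → ℝ) (φ : Fin m → ℝ) (γ : ℝ)
    (p : (Fin m → Fin n → ℝ) × (Fin m → ℝ)) : ℝ :=
  (1 - γ) * ∑ i, φ i * p.2 i + γ * ∑ i, ∑ j, d i j * p.1 i j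

/-- Dual feasibility of the tuple `(π, μ, σ, η, τ, ν)`. -/
def DualFeasible (lam : Fin m → ℝ) (d : Fin m → Fin n → ℝ) (φ : Fin m → ℝ) (γ : ℝ)
    (π : Fin n → ℝ) (μ : Fin m → ℝ) (σ : Fin m → Fin n → ℝ)
    (η τ : Fin m → Fin m → ℝ) (ν : Fin m → ℝ) : Prop :=
  (∀ j, 0 ≤ π j) ∧ (∀ i j, 0 ≤ σ i j) ∧ (∀ i, 0 ≤ ν i) ∧
  (∀ i i' : Fin m, i < i' → 0 ≤ η i i') ∧ (∀ i i' : Fin m, i < i' → 0 ≤ τ i i') ∧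
  (∀ i j, -π j + μ i - σ i j ≤ γ * d i j) ∧
  (∀ i, μ i - (1 / lam i) * (∑ l ∈ univ.filter (fun l => i < l), (η i l - τ i l))
      + (1 / lam i) * (∑ l ∈ univ.filter (fun l => l < i), (η l i - τ l i))
      - ν i / lam i ≤ (1 - γ) * φ i)

/-- The dual objective `D_z(π, μ, σ, η, τ, ν)`. -/
def Dobj (lam : Fin m → ℝ) (C : Fin n → ℝ) (a : Fin m → Fin n → ℝ)
    (θ β : ℝ) (z : Fin n → ℝ)
    (π : Fin n → ℝ) (μ : Fin m → ℝ) (σ : Fin m → Fin n → ℝ)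
    (η τ : Fin m → Fin m → ℝ) (ν : Fin m → ℝ) : ℝ :=
  -(∑ j, C j * (1 - z j) * π j) + ∑ i, lam i * μ i - ∑ i, ∑ j, C j * a i j * σ i j
    - β * ∑ i, ∑ i' ∈ univ.filter (fun i' => i < i'), (η i i' + τ i i')
    - θ * ∑ i, ν i

/-- **Farkas' lemma**, algebraic form: a linear functional that is nonnegative wherever finitely many
linear functionals are nonnegative is a nonnegative combination of them. -/
theorem exists_nonneg_combination_of_nonneg {V ι : Type*} [AddCommGroup V] [Module ℝ V]
    (s : Finset ι) (f : ι → V →ₗ[ℝ] ℝ) (g : V →ₗ[ℝ] ℝ)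
    (h : ∀ x, (∀ k ∈ s, 0 ≤ f k x) → 0 ≤ g x) :
    ∃ c : ι → ℝ, (∀ k, 0 ≤ c k) ∧ ∀ x, g x = ∑ k ∈ s, c k * f k x := by
  classical
  induction s using Finset.induction_on generalizing f g with
  | empty =>
    refine ⟨0, fun _ => le_rfl, fun x => ?_⟩
    have h₁ := h x (by simp)
    have h₂ := h (-x) (by simp)
    rw [map_neg] at h₂
    rw [sum_empty]
    linarith
  | insert k₀ s hk₀ ih =>
    by_cases hs : ∀ x, (∀ k ∈ s, 0 ≤ f k x) → 0 ≤ g x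
    · obtain ⟨c, hc, hg⟩ := ih f g hs
      refine ⟨Function.update c k₀ 0, fun k => ?_, fun x => ?_⟩
      · by_cases hk : k = k₀
        · simp [hk]
        · simpa [hk] using hc k
      · rw [sum_insert hk₀, hg x]
        simp only [Function.update_self, zero_mul, zero_add]
        refine sum_congr rfl fun k hk => ?_
        rw [Function.update_of_ne (ne_of_mem_of_not_mem hk hk₀)]
    · push Not at hs
      obtain ⟨x₀, hx₀, hgx₀⟩ := hs
      have hf₀ : f k₀ x₀ < 0 := by
        by_contra! hcon
        refine absurd (h x₀ fun k hk => ?_) (not_le.mpr hgx₀)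
        rcases mem_insert.mp hk with rfl | hk
        exacts [hcon, hx₀ k hk]
      set r : ℝ := (-f k₀ x₀)⁻¹ with hr
      have hr₀ : 0 < r := inv_pos.mpr (by linarith)
      have hrf : r * f k₀ x₀ = -1 := by
        rw [hr, inv_neg, neg_mul, inv_mul_cancel₀ hf₀.ne]
      -- project along `x₀` onto the kernel of `f k₀`
      obtain ⟨c, hc, hg⟩ := ih (fun k => f k + (r * f k x₀) • f k₀) (g + (r * g x₀) • f k₀) <| by
        intro x hx
        have := h (x + (r * f k₀ x) • x₀) fun k hk => by
          simp only [map_add, map_smul, smul_eq_mul]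
          rcases mem_insert.mp hk with rfl | hk
          · have : r * f k x * f k x₀ = -f k x := by linear_combination f k x * hrf
            linarith
          · have := hx k hk
            simp only [LinearMap.add_apply, LinearMap.smul_apply, smul_eq_mul] at this
            linarith
        simp only [map_add, map_smul, smul_eq_mul] at this
        simp only [LinearMap.add_apply, LinearMap.smul_apply, smul_eq_mul]
        linarith
      refine ⟨Function.update c k₀ (∑ k ∈ s, c k * (r * f k x₀) - r * g x₀), fun k => ?_,
        fun x => ?_⟩
      · by_cases hk : k = k₀
        · subst hk
          have h₁ : 0 ≤ ∑ l ∈ s, c l * (r * f l x₀) :=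
            sum_nonneg fun l hl => mul_nonneg (hc l) (mul_nonneg hr₀.le (hx₀ l hl))
          have h₂ : r * g x₀ ≤ 0 := mul_nonpos_of_nonneg_of_nonpos hr₀.le hgx₀.le
          simp only [Function.update_self]
          linarith
        · simpa [hk] using hc k
      · have hgx := hg x
        simp only [LinearMap.add_apply, LinearMap.smul_apply, smul_eq_mul, mul_add,
          sum_add_distrib] at hgx
        have h₁ : ∑ k ∈ s, Function.update c k₀ (∑ k ∈ s, c k * (r * f k x₀) - r * g x₀) k * f k x
            = ∑ k ∈ s, c k * f k x := sum_congr rfl fun k hk => by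
          rw [Function.update_of_ne (ne_of_mem_of_not_mem hk hk₀)]
        rw [sum_insert hk₀, h₁, Function.update_self, sub_mul, sum_mul]
        simp only [← mul_assoc] at hgx ⊢
        linarith

/-- Affine form of **Farkas' lemma**: a lower bound of a linear functional on a nonempty polyhedron
is certified by a nonnegative combination of the constraints. -/
theorem exists_nonneg_combination_of_le {V ι : Type*} [AddCommGroup V] [Module ℝ V] [Fintype ι]
    (f : ι → V →ₗ[ℝ] ℝ) (b : ι → ℝ) (g : V →ₗ[ℝ] ℝ) (v : ℝ)
    (hne : ∃ x, ∀ k, b k ≤ f k x) (h : ∀ x, (∀ k, b k ≤ f k x) → v ≤ g x) :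
    ∃ c : ι → ℝ, (∀ k, 0 ≤ c k) ∧ (∀ x, g x = ∑ k, c k * f k x) ∧ v ≤ ∑ k, c k * b k := by
  classical
  obtain ⟨x₀, hx₀⟩ := hne
  let F : Option ι → V × ℝ →ₗ[ℝ] ℝ := fun o =>
    o.elim (LinearMap.snd ℝ V ℝ)
      fun k => f k ∘ₗ LinearMap.fst ℝ V ℝ - b k • LinearMap.snd ℝ V ℝ
  obtain ⟨c, hc, hg⟩ := exists_nonneg_combination_of_nonneg univ F
    (g ∘ₗ LinearMap.fst ℝ V ℝ - v • LinearMap.snd ℝ V ℝ) <| by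
      rintro ⟨x, t⟩ hx
      have ht : 0 ≤ t := hx none (mem_univ _)
      have hf : ∀ k, b k * t ≤ f k x := fun k => by
        simpa [F] using hx (some k) (mem_univ _)
      suffices v * t ≤ g x by simpa using this
      rcases ht.eq_or_lt with rfl | ht
      · by_contra! hgx
        rw [mul_zero] at hgx
        have h₁ := h (x₀ + ((g x₀ - v + 1) / (-g x)) • x) fun k => by
          have h₂ := hf k
          have h₃ : 0 ≤ (g x₀ - v + 1) / (-g x) :=
            div_nonneg (by linarith [h x₀ hx₀]) (by linarith)
          have h₄ : 0 ≤ f k x := by simpa using h₂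
          simp only [map_add, map_smul, smul_eq_mul]
          linarith [hx₀ k, mul_nonneg h₃ h₄]
        simp only [map_add, map_smul, smul_eq_mul] at h₁
        have h₂ : (g x₀ - v + 1) / (-g x) * g x = -(g x₀ - v + 1) := by
          field_simp [hgx.ne]
        linarith
      · have h₁ := h (t⁻¹ • x) fun k => by
          rw [map_smul, smul_eq_mul, inv_mul_eq_div, le_div_iff₀ ht]
          exact hf k
        rwa [map_smul, smul_eq_mul, inv_mul_eq_div, le_div_iff₀ ht] at h₁
  refine ⟨fun k => c (some k), fun k => hc _, fun x => ?_, ?_⟩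
  · simpa [F, Fintype.sum_option] using hg (x, 0)
  · have h₁ := hg (0, 1)
    simp only [Fintype.sum_option, F, Option.elim, LinearMap.sub_apply, LinearMap.comp_apply,
      LinearMap.smul_apply, LinearMap.fst_apply, LinearMap.snd_apply, map_zero, smul_eq_mul,
      mul_one, zero_sub, mul_neg, sum_neg_distrib] at h₁
    linarith [hc none]

/-- The left-hand side of the dual constraint attached to the unmet demand of area `i`. -/
noncomputable def unmetCoeff (lam μ : Fin m → ℝ) (η τ : Fin m → Fin m → ℝ) (ν : Fin m → ℝ) (i : Fin m) : ℝ :=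
  μ i - (1 / lam i) * (∑ l ∈ univ.filter (fun l => i < l), (η i l - τ i l))
      + (1 / lam i) * (∑ l ∈ univ.filter (fun l => l < i), (η l i - τ l i)) - ν i / lam i

/-- Exchange of summation in the pairwise fairness terms. -/
theorem sum_pairs_mul_sub (w : Fin m → Fin m → ℝ) (y : Fin m → ℝ) :
    ∑ i, ∑ l ∈ univ.filter (fun l => i < l), w i l * (y i - y l) =
      ∑ i, ((∑ l ∈ univ.filter (fun l => i < l), w i l)
        - ∑ l ∈ univ.filter (fun l => l < i), w l i) * y i := by
  have h : ∑ i, ∑ l ∈ univ.filter (fun l => i < l), w i l * y l =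
      ∑ i, ∑ l ∈ univ.filter (fun l => l < i), w l i * y i := by
    simp only [sum_filter]
    exact sum_comm
  simp only [mul_sub, sub_mul, sum_sub_distrib, sum_mul, h]

/-- The Lagrangian terms of the primal constraints, collected by primal variable. -/
theorem lagrangian_eq (lam : Fin m → ℝ) (π : Fin n → ℝ) (μ : Fin m → ℝ) (σ : Fin m → Fin n → ℝ)
    (η τ : Fin m → Fin m → ℝ) (ν : Fin m → ℝ) (x : Fin m → Fin n → ℝ) (q : Fin m → ℝ) :
    ∑ i, ∑ j, (-π j + μ i - σ i j) * x i j + ∑ i, unmetCoeff lam μ η τ ν i * q i =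
      -(∑ j, π j * ∑ i, x i j) + ∑ i, μ i * ((∑ j, x i j) + q i) - ∑ i, ∑ j, σ i j * x i j
      - ∑ i, ∑ l ∈ univ.filter (fun l => i < l),
          (η i l - τ i l) * (q i / lam i - q l / lam l)
      - ∑ i, ν i * (q i / lam i) := by
  have h₁ : ∑ j, π j * ∑ i, x i j = ∑ i, ∑ j, π j * x i j := by
    simp only [mul_sum]
    exact sum_comm
  have h₂ : ∑ i, unmetCoeff lam μ η τ ν i * q i =
      ∑ i, μ i * q i - ∑ i, ((∑ l ∈ univ.filter (fun l => i < l), (η i l - τ i l))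
        - ∑ l ∈ univ.filter (fun l => l < i), (η l i - τ l i)) * (q i / lam i)
      - ∑ i, ν i * (q i / lam i) := by
    rw [← sum_sub_distrib, ← sum_sub_distrib]
    refine sum_congr rfl fun i _ => ?_
    rw [unmetCoeff]
    ring
  rw [h₁, h₂, sum_pairs_mul_sub (fun i l => η i l - τ i l) (fun i => q i / lam i)]
  simp only [sub_mul, add_mul, neg_mul, mul_add, sum_sub_distrib, sum_add_distrib,
    sum_neg_distrib, mul_sum]
  ring

/-- The defender's cost, with the weights distributed over the sums. -/
theorem cost_eq (d : Fin m → Fin n → ℝ) (φ : Fin m → ℝ) (γ : ℝ)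
    (p : (Fin m → Fin n → ℝ) × (Fin m → ℝ)) :
    cost d φ γ p = ∑ i, ∑ j, γ * d i j * p.1 i j + ∑ i, (1 - γ) * φ i * p.2 i := by
  simp only [cost, mul_sum, mul_assoc]
  ring

/-- **Weak duality** for the defender's problem. -/
theorem Dobj_le_cost {lam : Fin m → ℝ} {C : Fin n → ℝ} {a : Fin m → Fin n → ℝ}
    {d : Fin m → Fin n → ℝ} {φ : Fin m → ℝ} {γ θ β : ℝ} {z : Fin n → ℝ}
    {π : Fin n → ℝ} {μ : Fin m → ℝ} {σ : Fin m → Fin n → ℝ}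
    {η τ : Fin m → Fin m → ℝ} {ν : Fin m → ℝ}
    (hD : DualFeasible lam d φ γ π μ σ η τ ν)
    {p : (Fin m → Fin n → ℝ) × (Fin m → ℝ)} (hp : p ∈ Feas lam C a θ β z) :
    Dobj lam C a θ β z π μ σ η τ ν ≤ cost d φ γ p := by
  obtain ⟨hπ, hσ, hν, hη, hτ, hx, hq⟩ := hD
  obtain ⟨px, pq, hcap, hdem, helig, hθ, hβ⟩ := hp
  have e₁ : ∑ i, ∑ j, (-π j + μ i - σ i j) * p.1 i j ≤ ∑ i, ∑ j, γ * d i j * p.1 i j :=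
    sum_le_sum fun i _ => sum_le_sum fun j _ => mul_le_mul_of_nonneg_right (hx i j) (px i j)
  have e₂ : ∑ i, unmetCoeff lam μ η τ ν i * p.2 i ≤ ∑ i, (1 - γ) * φ i * p.2 i :=
    sum_le_sum fun i _ => mul_le_mul_of_nonneg_right (hq i) (pq i)
  have e₃ : ∑ j, π j * ∑ i, p.1 i j ≤ ∑ j, C j * (1 - z j) * π j :=
    sum_le_sum fun j _ => by nlinarith [hπ j, hcap j]
  have e₄ : ∑ i, μ i * ((∑ j, p.1 i j) + p.2 i) = ∑ i, lam i * μ i :=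
    sum_congr rfl fun i _ => by rw [hdem i, mul_comm]
  have e₅ : ∑ i, ∑ j, σ i j * p.1 i j ≤ ∑ i, ∑ j, C j * a i j * σ i j :=
    sum_le_sum fun i _ => sum_le_sum fun j _ => by nlinarith [hσ i j, helig i j]
  have e₆ : ∑ i, ∑ l ∈ univ.filter (fun l => i < l),
      (η i l - τ i l) * (p.2 i / lam i - p.2 l / lam l) ≤
      β * ∑ i, ∑ l ∈ univ.filter (fun l => i < l), (η i l + τ i l) := by
    simp only [mul_sum]
    refine sum_le_sum fun i _ => sum_le_sum fun l hl => ?_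
    have hil := (mem_filter.mp hl).2
    obtain ⟨h₁, h₂⟩ := abs_le.mp (hβ i l)
    nlinarith [hη i l hil, hτ i l hil]
  have e₇ : ∑ i, ν i * (p.2 i / lam i) ≤ θ * ∑ i, ν i := by
    rw [mul_sum]
    exact sum_le_sum fun i _ => by nlinarith [hν i, hθ i]
  have e := lagrangian_eq lam π μ σ η τ ν p.1 p.2
  rw [cost_eq, Dobj]
  linarith

/-- The defender's feasible set is compact. -/
theorem isCompact_Feas (lam : Fin m → ℝ) (C : Fin n → ℝ) (a : Fin m → Fin n → ℝ)
    (θ β : ℝ) (z : Fin n → ℝ) : IsCompact (Feas lam C a θ β z) := by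
  refine (isCompact_Icc (a := ((0, 0) : (Fin m → Fin n → ℝ) × (Fin m → ℝ)))
    (b := (fun i j => C j * a i j, lam))).of_isClosed_subset ?_ ?_
  · simp only [Feas, Set.ofPred_and, Set.ofPred_forall]
    refine IsClosed.inter ?_ <| IsClosed.inter ?_ <| IsClosed.inter ?_ <| IsClosed.inter ?_ <|
      IsClosed.inter ?_ <| IsClosed.inter ?_ ?_
    · exact isClosed_iInter fun i => isClosed_iInter fun j =>
        isClosed_le (by fun_prop) (by fun_prop)
    · exact isClosed_iInter fun i => isClosed_le (by fun_prop) (by fun_prop)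
    · exact isClosed_iInter fun j => isClosed_le (by fun_prop) (by fun_prop)
    · exact isClosed_iInter fun i => isClosed_eq (by fun_prop) (by fun_prop)
    · exact isClosed_iInter fun i => isClosed_iInter fun j =>
        isClosed_le (by fun_prop) (by fun_prop)
    · exact isClosed_iInter fun i => isClosed_le (by fun_prop) (by fun_prop)
    · exact isClosed_iInter fun i => isClosed_iInter fun i' =>
        isClosed_le (by fun_prop) (by fun_prop)
  · rintro p ⟨px, pq, -, hdem, helig, -, -⟩
    refine ⟨⟨px, pq⟩, ⟨helig, fun i => ?_⟩⟩
    have := sum_nonneg fun j (_ : j ∈ univ) => px i j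
    linarith [hdem i]

/-- Any lower bound of the cost on a nonempty feasible set is a lower bound of the dual objective
at some dual-feasible tuple. -/
theorem exists_dualFeasible_le_Dobj {lam : Fin m → ℝ} {C : Fin n → ℝ} {a : Fin m → Fin n → ℝ}
    (d : Fin m → Fin n → ℝ) (φ : Fin m → ℝ) (γ : ℝ) {θ β : ℝ} (hβ : 0 ≤ β) {z : Fin n → ℝ}
    (hne : (Feas lam C a θ β z).Nonempty) (v : ℝ)
    (hv : ∀ p ∈ Feas lam C a θ β z, v ≤ cost d φ γ p) :
    ∃ (π : Fin n → ℝ) (μ : Fin m → ℝ) (σ : Fin m → Fin n → ℝ)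
      (η τ : Fin m → Fin m → ℝ) (ν : Fin m → ℝ),
      DualFeasible lam d φ γ π μ σ η τ ν ∧ v ≤ Dobj lam C a θ β z π μ σ η τ ν := by
  let V := (Fin m → Fin n → ℝ) × (Fin m → ℝ)
  let X : Fin m → Fin n → V →ₗ[ℝ] ℝ := fun i j =>
    LinearMap.proj (φ := fun _ : Fin n => ℝ) j ∘ₗ
      LinearMap.proj (φ := fun _ : Fin m => Fin n → ℝ) i ∘ₗ LinearMap.fst ℝ _ _
  let Q : Fin m → V →ₗ[ℝ] ℝ := fun i =>
    LinearMap.proj (φ := fun _ : Fin m => ℝ) i ∘ₗ LinearMap.snd ℝ _ _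
  have hX : ∀ i j (p : V), X i j p = p.1 i j := fun _ _ _ => rfl
  have hQ : ∀ i (p : V), Q i p = p.2 i := fun _ _ => rfl
  let G : V →ₗ[ℝ] ℝ := ∑ i, ∑ j, (γ * d i j) • X i j + ∑ i, ((1 - γ) * φ i) • Q i
  have hG : ∀ p, G p = cost d φ γ p := fun p => by
    simp [G, cost_eq, hX, hQ, LinearMap.sum_apply]
  let F : (Fin m × Fin n) ⊕ Fin m ⊕ Fin n ⊕ Fin m ⊕ Fin m ⊕ (Fin m × Fin n) ⊕ Fin m ⊕
      (Fin m × Fin m) ⊕ (Fin m × Fin m) → V →ₗ[ℝ] ℝ :=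
    Sum.elim (fun k => X k.1 k.2) <| Sum.elim Q <| Sum.elim (fun j => -∑ i, X i j) <|
    Sum.elim (fun i => ∑ j, X i j + Q i) <| Sum.elim (fun i => -(∑ j, X i j + Q i)) <|
    Sum.elim (fun k => -X k.1 k.2) <| Sum.elim (fun i => -((lam i)⁻¹ • Q i)) <|
    Sum.elim
      (fun k => if k.1 < k.2 then -((lam k.1)⁻¹ • Q k.1 - (lam k.2)⁻¹ • Q k.2) else 0)
      (fun k => if k.1 < k.2 then (lam k.1)⁻¹ • Q k.1 - (lam k.2)⁻¹ • Q k.2 else 0)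
  let B : (Fin m × Fin n) ⊕ Fin m ⊕ Fin n ⊕ Fin m ⊕ Fin m ⊕ (Fin m × Fin n) ⊕ Fin m ⊕
      (Fin m × Fin m) ⊕ (Fin m × Fin m) → ℝ :=
    Sum.elim (fun _ => 0) <| Sum.elim (fun _ => 0) <| Sum.elim (fun j => -(C j * (1 - z j))) <|
    Sum.elim lam <| Sum.elim (fun i => -lam i) <|
    Sum.elim (fun k => -(C k.2 * a k.1 k.2)) <| Sum.elim (fun _ => -θ) <|
    Sum.elim (fun k => if k.1 < k.2 then -β else 0) (fun k => if k.1 < k.2 then -β else 0)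
  have hFB : ∀ p : V, (∀ k, B k ≤ F k p) ↔ p ∈ Feas lam C a θ β z := by
    intro p
    simp only [Sum.forall, Prod.forall, F, B, Sum.elim_inl, Sum.elim_inr, LinearMap.neg_apply,
      LinearMap.add_apply, LinearMap.sum_apply, LinearMap.smul_apply, smul_eq_mul, hX, hQ,
      neg_le_neg_iff, inv_mul_eq_div]
    constructor
    · rintro ⟨px, pq, hcap, hd₁, hd₂, helig, hθ, hη, hτ⟩
      have hlt : ∀ i l, i < l → |p.2 i / lam i - p.2 l / lam l| ≤ β := fun i l hil => by
        have h₁ := hη i l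
        have h₂ := hτ i l
        simp only [if_pos hil, LinearMap.neg_apply, LinearMap.sub_apply, LinearMap.smul_apply,
          smul_eq_mul, hQ, neg_le_neg_iff, inv_mul_eq_div] at h₁ h₂
        exact abs_le.mpr ⟨h₂, h₁⟩
      refine ⟨px, pq, hcap, fun i => (hd₂ i).antisymm (hd₁ i), helig, hθ, fun i l => ?_⟩
      rcases lt_trichotomy i l with hil | rfl | hil
      · exact hlt i l hil
      · simpa using hβ
      · rw [abs_sub_comm]
        exact hlt l i hil
    · rintro ⟨px, pq, hcap, hdem, helig, hθ, hβ'⟩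
      refine ⟨px, pq, hcap, fun i => (hdem i).ge, fun i => (hdem i).le, helig, hθ,
        fun i l => ?_, fun i l => ?_⟩
      all_goals
        obtain ⟨h₁, h₂⟩ := abs_le.mp (hβ' i l)
        split_ifs
        · simpa only [LinearMap.neg_apply, LinearMap.sub_apply, LinearMap.smul_apply,
            smul_eq_mul, hQ, neg_le_neg_iff, inv_mul_eq_div]
        · simp
  obtain ⟨c, hc, hg, hcv⟩ := exists_nonneg_combination_of_le F B G v
    (hne.imp fun p hp => (hFB p).mpr hp) fun p hp => (hG p).symm ▸ hv p ((hFB p).mp hp)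
  simp only [Fintype.sum_sum_type, Fintype.sum_prod_type] at hg hcv
  let u : Fin m → Fin n → ℝ := fun i j => c (.inl (i, j))
  let w : Fin m → ℝ := fun i => c (.inr (.inl i))
  let π : Fin n → ℝ := fun j => c (.inr (.inr (.inl j)))
  let μ₁ : Fin m → ℝ := fun i => c (.inr (.inr (.inr (.inl i))))
  let μ₂ : Fin m → ℝ := fun i => c (.inr (.inr (.inr (.inr (.inl i)))))
  let σ : Fin m → Fin n → ℝ := fun i j => c (.inr (.inr (.inr (.inr (.inr (.inl (i, j)))))))
  let ν : Fin m → ℝ := fun i => c (.inr (.inr (.inr (.inr (.inr (.inr (.inl i)))))))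
  let η : Fin m → Fin m → ℝ := fun i l =>
    c (.inr (.inr (.inr (.inr (.inr (.inr (.inr (.inl (i, l)))))))))
  let τ : Fin m → Fin m → ℝ := fun i l =>
    c (.inr (.inr (.inr (.inr (.inr (.inr (.inr (.inr (i, l)))))))))
  let μ : Fin m → ℝ := fun i => μ₁ i - μ₂ i
  have hid : ∀ p : V, ∑ i, ∑ j, γ * d i j * p.1 i j + ∑ i, (1 - γ) * φ i * p.2 i =
      ∑ i, ∑ j, (u i j + (-π j + μ i - σ i j)) * p.1 i j
        + ∑ i, (w i + unmetCoeff lam μ η τ ν i) * p.2 i := by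
    intro p
    have h₁ := hg p
    have h₂ := lagrangian_eq lam π μ σ η τ ν p.1 p.2
    have h₃ : ∀ (i l : Fin m), (if i < l then (lam i)⁻¹ • Q i - (lam l)⁻¹ • Q l else 0) p =
        if i < l then p.2 i / lam i - p.2 l / lam l else 0 := fun i l => by
      split_ifs <;> simp [hQ, inv_mul_eq_div]
    have h₄ : ∀ (i l : Fin m), (if i < l then -((lam i)⁻¹ • Q i - (lam l)⁻¹ • Q l) else 0) p =
        if i < l then -(p.2 i / lam i - p.2 l / lam l) else 0 := fun i l => by
      split_ifs <;> simp [hQ, inv_mul_eq_div]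
    rw [hG, cost_eq] at h₁
    simp only [F, Sum.elim_inl, Sum.elim_inr, LinearMap.neg_apply,
      LinearMap.add_apply, LinearMap.sum_apply, LinearMap.smul_apply, smul_eq_mul, hX, hQ,
      h₃, h₄, inv_mul_eq_div, mul_neg, sum_neg_distrib, mul_ite, mul_zero,
      ← sum_filter] at h₁
    have h₅ : ∀ i j, (u i j + (-π j + μ i - σ i j)) * p.1 i j =
        u i j * p.1 i j + (-π j + μ i - σ i j) * p.1 i j := fun _ _ => add_mul _ _ _
    have h₆ : ∀ i, (w i + unmetCoeff lam μ η τ ν i) * p.2 i =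
        w i * p.2 i + unmetCoeff lam μ η τ ν i * p.2 i := fun _ => add_mul _ _ _
    simp only [h₅, h₆, sum_add_distrib]
    simp only [sub_mul (μ₁ _) (μ₂ _), sub_mul (η _ _) (τ _ _), sum_sub_distrib, μ] at h₂
    simp only [μ]
    linarith
  have hx : ∀ i j, γ * d i j = u i j + (-π j + μ i - σ i j) := fun i j => by
    simpa [Pi.single_apply, ite_apply] using hid (Pi.single i (Pi.single j 1), 0)
  have hq : ∀ i, (1 - γ) * φ i = w i + unmetCoeff lam μ η τ ν i := fun i => by
    simpa [Pi.single_apply] using hid (0, Pi.single i 1)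
  refine ⟨π, μ, σ, η, τ, ν, ⟨fun _ => hc _, fun _ _ => hc _, fun _ => hc _, fun _ _ _ => hc _,
    fun _ _ _ => hc _, fun i j => ?_, fun i => ?_⟩, ?_⟩
  · linarith [hx i j, hc (.inl (i, j))]
  · rw [hq i]
    exact le_add_of_nonneg_left (hc _)
  · simp only [B, Sum.elim_inl, Sum.elim_inr, mul_neg, sum_neg_distrib, mul_ite, mul_zero,
      ← sum_filter, sum_const_zero] at hcv
    have h₁ : ∑ j, C j * (1 - z j) * π j = ∑ j, π j * (C j * (1 - z j)) :=
      sum_congr rfl fun _ _ => mul_comm _ _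
    have h₂ : ∑ i, lam i * μ i = ∑ i, μ₁ i * lam i - ∑ i, μ₂ i * lam i := by
      rw [← sum_sub_distrib]
      exact sum_congr rfl fun _ _ => by ring
    have h₃ : ∑ i, ∑ j, C j * a i j * σ i j = ∑ i, ∑ j, σ i j * (C j * a i j) :=
      sum_congr rfl fun _ _ => sum_congr rfl fun _ _ => mul_comm _ _
    have h₄ : β * ∑ i, ∑ l ∈ univ.filter (fun l => i < l), (η i l + τ i l) =
        ∑ i, ∑ l ∈ univ.filter (fun l => i < l), η i l * β
          + ∑ i, ∑ l ∈ univ.filter (fun l => i < l), τ i l * β := by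
      simp only [← sum_mul, sum_add_distrib]
      ring
    have h₅ : θ * ∑ i, ν i = ∑ i, ν i * θ := by rw [mul_comm, sum_mul]
    rw [Dobj, h₁, h₂, h₃, h₄, h₅]
    linarith

theorem stmt_7
    (m n : ℕ) (hm : 1 ≤ m) (hn : 1 ≤ n)
    (lam : Fin m → ℝ) (hlam : ∀ i, 0 < lam i)
    (C : Fin n → ℝ) (hC : ∀ j, 0 ≤ C j)
    (d : Fin m → Fin n → ℝ) (hd : ∀ i j, 0 ≤ d i j)
    (φ : Fin m → ℝ) (hφ : ∀ i, 0 ≤ φ i)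
    (a : Fin m → Fin n → ℝ) (ha : ∀ i j, a i j = 0 ∨ a i j = 1)
    (γ : ℝ) (hγ0 : 0 ≤ γ) (hγ1 : γ ≤ 1)
    (θ β : ℝ) (hθ : 0 ≤ θ) (hβ : 0 ≤ β)
    (z : Fin n → ℝ) (hz : ∀ j, z j = 0 ∨ z j = 1)
    (hne : (Feas lam C a θ β z).Nonempty) :
    ∃ p ∈ Feas lam C a θ β z,
      ∃ (π : Fin n → ℝ) (μ : Fin m → ℝ) (σ : Fin m → Fin n → ℝ)
        (η τ : Fin m → Fin m → ℝ) (ν : Fin m → ℝ),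
        DualFeasible lam d φ γ π μ σ η τ ν ∧
        (∀ p' ∈ Feas lam C a θ β z, cost d φ γ p ≤ cost d φ γ p') ∧
        (∀ (π' : Fin n → ℝ) (μ' : Fin m → ℝ) (σ' : Fin m → Fin n → ℝ)
          (η' τ' : Fin m → Fin m → ℝ) (ν' : Fin m → ℝ),
          DualFeasible lam d φ γ π' μ' σ' η' τ' ν' →
          Dobj lam C a θ β z π' μ' σ' η' τ' ν' ≤ Dobj lam C a θ β z π μ σ η τ ν) ∧
        cost d φ γ p = Dobj lam C a θ β z π μ σ η τ ν := by
  obtain ⟨p, hp, hmin⟩ := (isCompact_Feas lam C a θ β z).exists_isMinOn hne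
    (f := cost d φ γ) (by unfold cost; fun_prop)
  obtain ⟨π, μ, σ, η, τ, ν, hD, hle⟩ :=
    exists_dualFeasible_le_Dobj d φ γ hβ hne (cost d φ γ p) hmin
  have heq := hle.antisymm (Dobj_le_cost hD hp)
  exact ⟨p, hp, π, μ, σ, η, τ, ν, hD, hmin,
    fun _ _ _ _ _ _ hD' => (Dobj_le_cost hD' hp).trans heq.le, heq⟩
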